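/- Let D = (V,E) be an r-rooted digraph (possibly infinite). For every v ∈ V \ {r} there exists a ⊆-largest v-linked set in D, i.e., a v-linked set X_{v,D} containing every v-linked set; in particular, if some v-linked set exists, their union is v-linked. (Here the empty family of witnessing paths is allowed when δ_D(X) = ∅ fails to occur; if no v-linked set exists, take X_{v,D} to be the singleton {v} when {v} is v-linked.) Precisely: the union of all v-linked sets, if there is at least one v-linked set, is itself v-linked and hence is the ⊆-largest v-linked set X_{v,D}. -/

import Mathlib

/-- A digraph on vertex type `V` with edge type `E` (parallel edges allowed, no loops). -/
structure MultiDigraph (V : Type*) (E : Type*) where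
  tail : E → V
  head : E → V
  no_loops : ∀ e, tail e ≠ head e

namespace MultiDigraph

variable {V E : Type*}

/-- `p` is a (finite) directed path from `s` to `t` in the spanning subdigraph `D(L)`,
identified with its list of edges (consecutive edges are incident, visited vertices
are pairwise distinct). -/
def IsPathIn (D : MultiDigraph V E) (L : Set E) (s t : V) (p : List E) : Prop :=
  ∃ hne : p ≠ [],
    D.tail (p.head hne) = s ∧
    D.head (p.getLast hne) = t ∧
    p.Chain' (fun e f => D.head e = D.tail f) ∧
    (s :: p.map D.head).Nodup ∧
    ∀ e ∈ p, e ∈ L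

/-- `δ_{D(L)}(v)`: the set of ingoing edges of `v` lying in `L`. -/
def delta (D : MultiDigraph V E) (L : Set E) (v : V) : Set E :=
  {e | e ∈ L ∧ D.head e = v}

/-- `δ_{D(L)}(X)`: the set of edges of `D(L)` entering the vertex set `X`
(tail outside `X`, head inside `X`). -/
def edgesInto (D : MultiDigraph V E) (L : Set E) (X : Set V) : Set E :=
  {e | e ∈ L ∧ D.tail e ∉ X ∧ D.head e ∈ X}

/-- `I ∈ 𝒢_{D(L)}(v)`: `I` is a set of ingoing edges of `v` in `D(L)` for which
there is a set of pairwise edge-disjoint `r`–`v` paths of `D(L)` covering `I`. -/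
def MemGv (D : MultiDigraph V E) (L : Set E) (r v : V) (I : Set E) : Prop :=
  I ⊆ D.delta L v ∧
  ∃ Ps : Set (List E),
    (∀ p ∈ Ps, D.IsPathIn L r v p) ∧
    Ps.Pairwise (fun p q => p.Disjoint q) ∧
    ∀ e ∈ I, ∃ p ∈ Ps, e ∈ p

/-- `L' ∈ 𝒢(D(L))`: `L'` is a union `⋃_{v ≠ r} I_v` with `I_v ∈ 𝒢_{D(L)}(v)`;
equivalently, every edge of `L'` has head distinct from `r` and for each `v ≠ r`
the set of ingoing edges of `v` in `L'` belongs to `𝒢_{D(L)}(v)`. -/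
def MemG (D : MultiDigraph V E) (L : Set E) (r : V) (L' : Set E) : Prop :=
  L' ⊆ L ∧ (∀ e ∈ L', D.head e ≠ r) ∧
    ∀ v, v ≠ r → D.MemGv L r v (D.delta L' v)

/-- `F` is a flame: `F ∈ 𝒢(D(F))`. -/
def IsFlame (D : MultiDigraph V E) (r : V) (F : Set E) : Prop :=
  D.MemG F r F

/-- `C` is a transversal of the set `Ps` of paths: `C` consists of exactly one
edge from each path in `Ps`. -/
def IsTransversal (Ps : Set (List E)) (C : Set E) : Prop :=
  (∀ p ∈ Ps, ∃! e, e ∈ C ∧ e ∈ p) ∧ ∀ e ∈ C, ∃ p ∈ Ps, e ∈ p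

/-- `C` is an `s`–`t` cut in `D(L)`: every `s`–`t` path of `D(L)` meets `C`. -/
def IsCut (D : MultiDigraph V E) (L : Set E) (s t : V) (C : Set E) : Prop :=
  ∀ p, D.IsPathIn L s t p → ∃ e ∈ p, e ∈ C

/-- `L` is large at `v`: `D(L)` admits a set `Ps` of pairwise edge-disjoint
`r`–`v` paths together with a transversal of `Ps` that is an `r`–`v` cut in `D`. -/
def LargeAt (D : MultiDigraph V E) (r v : V) (L : Set E) : Prop :=
  ∃ (Ps : Set (List E)) (C : Set E),
    (∀ p ∈ Ps, D.IsPathIn L r v p) ∧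
    Ps.Pairwise (fun p q => p.Disjoint q) ∧
    IsTransversal Ps C ∧
    D.IsCut Set.univ r v C

/-- `L` is large: it is large at every `v ≠ r`. -/
def Large (D : MultiDigraph V E) (r : V) (L : Set E) : Prop :=
  ∀ v, v ≠ r → D.LargeAt r v L

/-- `D` contains a directed cycle. -/
def HasCycle (D : MultiDigraph V E) : Prop :=
  ∃ (p : List E) (hne : p ≠ []),
    p.Chain' (fun e f => D.head e = D.tail f) ∧
    D.head (p.getLast hne) = D.tail (p.head hne) ∧
    (p.map D.head).Nodup

/-- `D` contains a backward-infinite path: edges `…, f 2, f 1, f 0` (with `f 0` the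
last edge, so the path has a final vertex `D.head (f 0)` but no first vertex); the
visited vertices `D.head (f n)` are pairwise distinct. -/
def HasBackwardInfinitePath (D : MultiDigraph V E) : Prop :=
  ∃ f : ℕ → E,
    (∀ n, D.tail (f n) = D.head (f (n + 1))) ∧
    Function.Injective (fun n => D.head (f n))

/-- `X ⊆ V \ {r}` is `v`-linked in `D(L)`: `v ∈ X` and there is a family
`{P e : e ∈ δ_{D(L)}(X)}` of pairwise edge-disjoint paths of `D(L)`, where `P e`
has `e` as its initial edge and `v` as its terminal vertex. -/
def VLinked (D : MultiDigraph V E) (L : Set E) (r v : V) (X : Set V) : Prop :=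
  r ∉ X ∧ v ∈ X ∧
  ∃ P : E → List E,
    (∀ e ∈ D.edgesInto L X, D.IsPathIn L (D.tail e) v (P e) ∧ (P e).head? = some e) ∧
    (D.edgesInto L X).Pairwise (fun e f => (P e).Disjoint (P f))

/-- `p` is an `r`–`X` path in `D(L)`: a path starting at `r` meeting `X` exactly
in its last vertex. -/
def IsRXPathIn (D : MultiDigraph V E) (L : Set E) (r : V) (X : Set V) (p : List E) : Prop :=
  ∃ hne : p ≠ [],
    D.tail (p.head hne) = r ∧
    D.head (p.getLast hne) ∈ X ∧
    (∀ e ∈ p.dropLast, D.head e ∉ X) ∧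
    p.Chain' (fun e f => D.head e = D.tail f) ∧
    (r :: p.map D.head).Nodup ∧
    ∀ e ∈ p, e ∈ L

/-- `X` is fillable in `D(L)`: there is a set `Ps` of pairwise edge-disjoint
`r`–`X` paths in `D(L)` whose set of terminal edges is exactly `δ_{D(L)}(X)`. -/
def Fillable (D : MultiDigraph V E) (L : Set E) (r : V) (X : Set V) : Prop :=
  ∃ Ps : Set (List E),
    (∀ p ∈ Ps, D.IsRXPathIn L r X p) ∧
    Ps.Pairwise (fun p q => p.Disjoint q) ∧
    {e | ∃ p ∈ Ps, p.getLast? = some e} = D.edgesInto L X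

end MultiDigraph

namespace MultiDigraph

variable {V E : Type*}

/-- The edge-disjoint paths `P e` witnessing that a set `X` is `v`-linked. -/
def IsLinkage (D : MultiDigraph V E) (v : V) (X : Set V) (P : E → List E) : Prop :=
  (∀ e ∈ D.edgesInto Set.univ X,
    D.IsPathIn Set.univ (D.tail e) v (P e) ∧ (P e).head? = some e) ∧
  (D.edgesInto Set.univ X).Pairwise (fun e f => (P e).Disjoint (P f))

/-- Every walk can be shortened to a path with the same first edge. -/
theorem exists_nodup_of_isChain (D : MultiDigraph V E) (v : V) (l : List E) (e : E)
    (hc : (e :: l).IsChain (fun e f => D.head e = D.tail f))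
    (hlast : ∀ x ∈ (e :: l).getLast?, D.head x = v) :
    ∃ m : List E, (e :: m).IsChain (fun e f => D.head e = D.tail f) ∧
      (∀ x ∈ (e :: m).getLast?, D.head x = v) ∧ ((e :: m).map D.head).Nodup ∧ m ⊆ l := by
  induction l generalizing e with
  | nil => exact ⟨[], by simp, hlast, by simp, by simp⟩
  | cons f l ih =>
    rw [List.isChain_cons_cons] at hc
    obtain ⟨m, hmc, hml, hmn, hms⟩ := ih f hc.2 (by simpa using hlast)
    have hsub : f :: m ⊆ f :: l := List.cons_subset_cons f hms
    by_cases he : D.head e ∈ (f :: m).map D.head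
    · obtain ⟨x, hx, hxe⟩ := List.mem_map.1 he
      obtain ⟨a, b, hab⟩ := List.append_of_mem hx
      rw [hab] at hmc hml hmn hsub
      have hxb := (List.isChain_append.1 hmc).2.1
      refine ⟨b, ?_, ?_, ?_, fun y hy => hsub (by simp [hy])⟩
      · rw [List.isChain_cons] at hxb ⊢
        exact ⟨fun y hy => hxe ▸ hxb.1 y hy, hxb.2⟩
      · cases b with
        | nil => simpa [hxe] using hml
        | cons y b => simpa using hml
      · rw [List.map_append, List.nodup_append] at hmn
        simpa [hxe] using hmn.2.1
    · exact ⟨f :: m, by simpa [List.isChain_cons_cons] using ⟨hc.1, hmc⟩, by simpa using hml,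
        List.nodup_cons.2 ⟨he, hmn⟩, hsub⟩

namespace IsLinkage

variable {D : MultiDigraph V E} {v : V} {X : Set V} {P : E → List E}

theorem exists_eq_cons (h : D.IsLinkage v X P) {e : E} (he : e ∈ D.edgesInto Set.univ X) :
    ∃ l, P e = e :: l :=
  List.head?_eq_some_iff.1 (h.1 e he).2

theorem eq_of_mem (h : D.IsLinkage v X P) {e f x : E} (he : e ∈ D.edgesInto Set.univ X)
    (hf : f ∈ D.edgesInto Set.univ X) (hxe : x ∈ P e) (hxf : x ∈ P f) : e = f := by
  by_contra hne
  exact h.2 he hf hne hxe hxf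

theorem isChain (h : D.IsLinkage v X P) {e : E} (he : e ∈ D.edgesInto Set.univ X) :
    (P e).IsChain (fun e f => D.head e = D.tail f) := by
  obtain ⟨⟨_, _, _, hc, _⟩, _⟩ := h.1 e he
  exact hc

theorem nodup_heads (h : D.IsLinkage v X P) {e : E} (he : e ∈ D.edgesInto Set.univ X) :
    ((P e).map D.head).Nodup := by
  obtain ⟨⟨_, _, _, _, hn, _⟩, _⟩ := h.1 e he
  exact (List.nodup_cons.1 hn).2

theorem head_getLast (h : D.IsLinkage v X P) {e : E} (he : e ∈ D.edgesInto Set.univ X)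
    {a : List E} {x : E} (hx : P e = a ++ [x]) : D.head x = v := by
  obtain ⟨⟨_, _, hl, _⟩, _⟩ := h.1 e he
  simpa [hx] using hl

/-- The paths of a linkage of `X` never leave `X`. -/
theorem head_mem (h : D.IsLinkage v X P) (hv : v ∈ X) {e : E}
    (he : e ∈ D.edgesInto Set.univ X) (s a : List E) (hs : P e = a ++ s) :
    ∀ x ∈ s, D.head x ∈ X := by
  induction s generalizing a with
  | nil => simp
  | cons y s ih =>
    have hsX := ih (a ++ [y]) (by simpa using hs)
    refine List.forall_mem_cons.2 ⟨?_, hsX⟩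
    cases s with
    | nil => exact h.head_getLast he hs ▸ hv
    | cons z s =>
      by_contra hy
      have hyz : D.head y = D.tail z := by
        have := h.isChain he
        rw [hs] at this
        exact (List.isChain_cons_cons.1 (List.isChain_append.1 this).2.1).1
      have hz : z ∈ D.edgesInto Set.univ X :=
        ⟨trivial, hyz ▸ hy, hsX z (by simp)⟩
      obtain ⟨l, hl⟩ := h.exists_eq_cons hz
      have hze : e = z := h.eq_of_mem he hz (x := z) (by simp [hs]) (by simp [hl])
      subst hze
      have hn := (h.nodup_heads he).of_map
      rw [hs] at hl hn
      cases a with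
      | nil =>
        simp only [List.nil_append, List.cons.injEq] at hl
        simp [hl.1] at hn
      | cons b a =>
        simp only [List.cons_append, List.cons.injEq] at hl
        simp [hl.1] at hn

end IsLinkage

section Union

variable {ι : Type*}

/-- Given linkages `P i` of the sets `X i` and a choice `a u` of an index for each vertex `u`,
the edge `y` follows `x` if it does so in a path of the linkage chosen at the head of `x`. -/
def Follows (D : MultiDigraph V E) (X : ι → Set V) (P : ι → E → List E) (a : V → ι)
    (x y : E) : Prop :=
  D.head x ∈ X (a (D.head x)) ∧
    ∃ f ∈ D.edgesInto Set.univ (X (a (D.head x))), [x, y] <:+: P (a (D.head x)) f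

variable {D : MultiDigraph V E} {v : V} {X : ι → Set V} {P : ι → E → List E} {a : V → ι}

theorem Follows.head_eq_tail (hP : ∀ i, D.IsLinkage v (X i) (P i)) {x y : E}
    (h : D.Follows X P a x y) : D.head x = D.tail y := by
  obtain ⟨_, f, hf, hxy⟩ := h
  simpa using ((hP _).isChain hf).infix hxy

theorem Follows.head_mem_right (hP : ∀ i, D.IsLinkage v (X i) (P i)) (hv : ∀ i, v ∈ X i)
    {x y : E} (h : D.Follows X P a x y) : D.head y ∈ X (a (D.head x)) := by
  obtain ⟨_, f, hf, b, c, hs⟩ := h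
  exact (hP _).head_mem (hv _) hf ([x, y] ++ c) b (by simp [← hs]) y (by simp)

theorem Follows.left_unique (hP : ∀ i, D.IsLinkage v (X i) (P i)) {x x' y : E}
    (h : D.Follows X P a x y) (h' : D.Follows X P a x' y) : x = x' := by
  have hh : D.head x = D.head x' := (h.head_eq_tail hP).trans (h'.head_eq_tail hP).symm
  obtain ⟨_, f, hf, hxy⟩ := h
  obtain ⟨_, f', hf', hxy'⟩ := h'
  rw [← hh] at hf' hxy'
  obtain rfl := (hP _).eq_of_mem hf hf' (hxy.subset (by simp : y ∈ _))
    (hxy'.subset (by simp : y ∈ _))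
  exact List.inj_on_of_nodup_map ((hP _).nodup_heads hf) (hxy.subset (by simp))
    (hxy'.subset (by simp)) hh

/-- Two chains of successive edges starting at edges without predecessor have the same origin
once they meet. -/
theorem Follows.eq_of_reflTransGen (hP : ∀ i, D.IsLinkage v (X i) (P i)) {e e' x : E}
    (he : ∀ y, ¬ D.Follows X P a y e) (he' : ∀ y, ¬ D.Follows X P a y e')
    (h : Relation.ReflTransGen (D.Follows X P a) e x)
    (h' : Relation.ReflTransGen (D.Follows X P a) e' x) : e = e' := by
  have hu : Relator.RightUnique (Function.swap (D.Follows X P a)) :=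
    fun _ _ _ h₁ h₂ => Follows.left_unique hP h₁ h₂
  rcases Relation.ReflTransGen.total_of_right_unique hu h.swap h'.swap with h₁ | h₁
  · rcases h₁.cases_head with h₂ | ⟨y, hy, _⟩
    · exact h₂
    · exact (he y hy).elim
  · rcases h₁.cases_head with h₂ | ⟨y, hy, _⟩
    · exact h₂.symm
    · exact (he' y hy).elim

theorem exists_isChain_follows [LinearOrder ι] [WellFoundedLT ι] (hP : ∀ i, D.IsLinkage v (X i) (P i))
    (hv : ∀ i, v ∈ X i)
    (ha : ∀ u i, u ∈ X i → u ∈ X (a u) ∧ a u ≤ i) (i : ι) :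
    ∀ f ∈ D.edgesInto Set.univ (X i), ∀ (s b : List E) (x : E), P i f = b ++ x :: s →
      a (D.head x) = i →
      ∃ l : List E, (x :: l).IsChain (D.Follows X P a) ∧
        ∀ y ∈ (x :: l).getLast?, D.head y = v := by
  induction i using WellFoundedLT.induction with
  | ind i ih =>
    intro f hf s
    induction s with
    | nil =>
      intro b x hs _
      exact ⟨[], by simp, by simpa using (hP i).head_getLast hf hs⟩
    | cons y s ihs =>
      intro b x hs hx
      have hmem := (hP i).head_mem (hv i) hf _ _ hs
      have hxy : D.Follows X P a x y := by
        subst hx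
        exact ⟨hmem x (by simp), f, hf, b, s, by simp [hs]⟩
      suffices ∃ l : List E, (y :: l).IsChain (D.Follows X P a) ∧
          ∀ z ∈ (y :: l).getLast?, D.head z = v by
        obtain ⟨l, hl, hlv⟩ := this
        exact ⟨y :: l, List.isChain_cons_cons.2 ⟨hxy, hl⟩, by simpa using hlv⟩
      obtain ⟨hyX, hyi⟩ := ha _ _ (hmem y (by simp))
      rcases hyi.eq_or_lt with hy | hy
      · exact ihs (b ++ [x]) y (by simp [hs]) hy
      · have hye : y ∈ D.edgesInto Set.univ (X (a (D.head y))) := by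
          refine ⟨trivial, fun ht => ?_, hyX⟩
          rw [← hxy.head_eq_tail hP] at ht
          exact absurd (ha _ _ ht).2 (by rw [hx]; exact not_le.2 hy)
        obtain ⟨l, hl⟩ := (hP _).exists_eq_cons hye
        exact ih _ hy y hye l [] y (by simpa using hl) rfl

/-- A union of `v`-linked sets is `v`-linked. -/
theorem exists_isLinkage_iUnion [Nonempty ι] (hP : ∀ i, D.IsLinkage v (X i) (P i))
    (hv : ∀ i, v ∈ X i) : ∃ Q, D.IsLinkage v (⋃ i, X i) Q := by
  obtain ⟨_, _⟩ := exists_wellFoundedLT ι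
  have hleast : ∀ u, ∃ j, ∀ i, u ∈ X i → u ∈ X j ∧ j ≤ i := by
    intro u
    by_cases hu : ∃ i, u ∈ X i
    · obtain ⟨j, hj, hmin⟩ := WellFounded.has_min (wellFounded_lt (α := ι)) {i | u ∈ X i} hu
      exact ⟨j, fun i hi => ⟨hj, not_lt.1 (hmin i hi)⟩⟩
    · exact ⟨Classical.arbitrary ι, fun i hi => (hu ⟨i, hi⟩).elim⟩
  choose a ha using hleast
  have hpath : ∀ e, ∃ p : List E, e ∈ D.edgesInto Set.univ (⋃ i, X i) →
      (D.IsPathIn Set.univ (D.tail e) v p ∧ p.head? = some e) ∧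
        ∀ x ∈ p, Relation.ReflTransGen (D.Follows X P a) e x := by
    intro e
    by_cases he : e ∈ D.edgesInto Set.univ (⋃ i, X i)
    swap
    · exact ⟨[], fun h => (he h).elim⟩
    obtain ⟨-, ht, hh⟩ := he
    simp only [Set.mem_iUnion, not_exists] at ht hh
    obtain ⟨i, hi⟩ := hh
    have hea : e ∈ D.edgesInto Set.univ (X (a (D.head e))) := ⟨trivial, ht _, (ha _ _ hi).1⟩
    obtain ⟨s, hs⟩ := (hP _).exists_eq_cons hea
    obtain ⟨l, hl, hlv⟩ := exists_isChain_follows hP hv ha _ e hea s [] e hs rfl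
    obtain ⟨m, hmc, hmv, hmn, hml⟩ := exists_nodup_of_isChain D v l e
      (hl.imp fun _ _ h => h.head_eq_tail hP) hlv
    have hreach : ∀ x ∈ e :: l, Relation.ReflTransGen (D.Follows X P a) e x :=
      hl.induction _ _ (fun _ _ h h' => h'.tail h) fun _ => .refl
    have hmreach : ∀ x ∈ e :: m, Relation.ReflTransGen (D.Follows X P a) e x :=
      fun x hx => hreach x (List.cons_subset_cons e hml hx)
    refine ⟨e :: m, fun _ => ⟨⟨⟨by simp, rfl, hmv _ (List.getLast?_eq_getLast_of_ne_nil _), hmc,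
      List.nodup_cons.2 ⟨fun hmem => ?_, hmn⟩, fun _ _ => trivial⟩, rfl⟩, hmreach⟩⟩
    obtain ⟨x, hx, hxe⟩ := List.mem_map.1 hmem
    rcases (hmreach x hx).cases_tail with h | ⟨y, -, hy⟩
    · exact D.no_loops e (h ▸ hxe).symm
    · exact ht _ (hxe ▸ hy.head_mem_right hP hv)
  choose Q hQ using hpath
  refine ⟨Q, fun e he => (hQ e he).1, fun e he f hf hne x hxe hxf => hne ?_⟩
  have hsource : ∀ g ∈ D.edgesInto Set.univ (⋃ i, X i), ∀ y, ¬ D.Follows X P a y g :=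
    fun g hg y hy => hg.2.1 (hy.head_eq_tail hP ▸ Set.mem_iUnion.2 ⟨_, hy.1⟩)
  exact Follows.eq_of_reflTransGen hP (hsource e he) (hsource f hf)
    ((hQ e he).2 x hxe) ((hQ f hf).2 x hxf)

end Union

end MultiDigraph

/-- If there is at least one `v`-linked set, then the union of all
`v`-linked sets is itself `v`-linked, hence it is the `⊆`-largest `v`-linked set. -/
theorem stmt5 {V E : Type*} (D : MultiDigraph V E) (r : V)
    (hroot : ∀ e, D.head e ≠ r)
    (v : V) (hv : v ≠ r)
    (hex : ∃ X : Set V, D.VLinked Set.univ r v X) :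
    D.VLinked Set.univ r v (⋃₀ {X : Set V | D.VLinked Set.univ r v X}) ∧
    ∀ X : Set V, D.VLinked Set.univ r v X →
      X ⊆ ⋃₀ {X : Set V | D.VLinked Set.univ r v X} := by
  refine ⟨⟨?_, ?_, ?_⟩, fun X hX => Set.subset_sUnion_of_mem hX⟩
  · rintro ⟨X, hX, hr⟩
    exact hX.1 hr
  · obtain ⟨X, hX⟩ := hex
    exact ⟨X, hX, hX.2.1⟩
  · let ι := {X : Set V // D.VLinked Set.univ r v X}
    have : Nonempty ι := hex.elim fun X hX => ⟨⟨X, hX⟩⟩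
    have hlink : ∀ i : ι, ∃ P, D.IsLinkage v i.1 P := fun i => i.2.2.2
    choose P hP using hlink
    rw [Set.sUnion_eq_iUnion]
    exact MultiDigraph.exists_isLinkage_iUnion (X := fun i : ι => i.1) hP fun i => i.2.2.1
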